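/- arXiv:2007.15180 — 4 statements merged into one kernel-verified Lean document; each statement's English description precedes it below -/
import Mathlib

section
/- Let δ be a nonzero real algebraic number and let l₁, …, l_k be positive integers. Then there exist infinitely many positive integers l such that for every i with 1 ≤ i ≤ k, the real number (lᵢ/l)² does not belong to the set δ^ℤ = {δⁿ : n ∈ ℤ}. -/
/-- Two distinct large primes cannot both be bad. -/
theorem aux_prime (δ : ℝ) (a b p q : ℕ) (hp : p.Prime) (hq : q.Prime) (hpq : p ≠ q)
    (ha : 0 < a) (hb : 0 < b) (hap : a < p) (hbp : b < p) (hbq : b < q) (n n' : ℤ)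
    (h1 : ((a : ℝ) / (p : ℝ)) ^ 2 = δ ^ n) (h2 : ((b : ℝ) / (q : ℝ)) ^ 2 = δ ^ n') : False := by
  have hR : (((a : ℝ) / (p : ℝ)) ^ 2) ^ n' = (((b : ℝ) / (q : ℝ)) ^ 2) ^ n := by
    rw [h1, h2, ← zpow_mul, ← zpow_mul, mul_comm]
  have hQ : (((a : ℚ) / (p : ℚ)) ^ 2) ^ n' = (((b : ℚ) / (q : ℚ)) ^ 2) ^ n := by
    apply Rat.cast_injective (α := ℝ)
    push_cast
    exact hR
  have : Fact p.Prime := ⟨hp⟩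
  have ha0 : (a : ℚ) ≠ 0 := by exact_mod_cast ha.ne'
  have hb0 : (b : ℚ) ≠ 0 := by exact_mod_cast hb.ne'
  have hp0 : (p : ℚ) ≠ 0 := by exact_mod_cast hp.ne_zero
  have hq0 : (q : ℚ) ≠ 0 := by exact_mod_cast hq.ne_zero
  have va : padicValNat p a = 0 :=
    padicValNat.eq_zero_of_not_dvd (Nat.not_dvd_of_pos_of_lt ha hap)
  have vb : padicValNat p b = 0 :=
    padicValNat.eq_zero_of_not_dvd (Nat.not_dvd_of_pos_of_lt hb hbp)
  have vq : padicValNat p q = 0 :=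
    padicValNat.eq_zero_of_not_dvd (fun h => hpq ((Nat.prime_dvd_prime_iff_eq hp hq).1 h))
  have hv := congrArg (padicValRat p) hQ
  rw [padicValRat.zpow, padicValRat.zpow, padicValRat.pow, padicValRat.pow,
    padicValRat.div ha0 hp0, padicValRat.div hb0 hq0] at hv
  simp only [padicValRat.of_nat, va, vb, vq, padicValNat_self] at hv
  have hn : n' = 0 := by push_cast at hv; linarith
  rw [hn, zpow_zero] at h2
  have hq1 : (0 : ℝ) < q := by exact_mod_cast hq.pos
  have h3 : (b : ℝ) / q < 1 := by rw [div_lt_one hq1]; exact_mod_cast hbq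
  have h4 : (0 : ℝ) ≤ (b : ℝ) / q := by positivity
  nlinarith

/-- Lemma 5.3: for a nonzero real algebraic number `δ` and positive integers
`l₁, …, l_k`, there are infinitely many positive integers `l` such that
`(lᵢ/l)²` is not an integer power of `δ` for any `i`. -/
theorem stmt_0 (δ : ℝ) (hδ : δ ≠ 0) (halg : IsAlgebraic ℚ δ)
    (k : ℕ) (l : Fin k → ℕ) (hl : ∀ i, 0 < l i) :
    {m : ℕ | 0 < m ∧ ∀ i : Fin k, ∀ n : ℤ,
      ((l i : ℝ) / (m : ℝ)) ^ 2 ≠ δ ^ n}.Infinite := by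
  have hB : ∀ i, l i ≤ ∑ j, l j := fun i =>
    Finset.single_le_sum (f := l) (fun _ _ => Nat.zero_le _) (Finset.mem_univ i)
  rw [Set.infinite_iff_exists_gt]
  intro N
  obtain ⟨p, hpN, hp⟩ := Nat.exists_infinite_primes (N + ∑ j, l j + 1)
  obtain ⟨q, hqN, hq⟩ := Nat.exists_infinite_primes (p + 1)
  by_contra hcon
  have key : ∀ r : ℕ, r.Prime → N < r → ∃ i : Fin k, ∃ n : ℤ,
      ((l i : ℝ) / (r : ℝ)) ^ 2 = δ ^ n := by
    intro r hr hN
    by_contra h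
    push Not at h
    exact hcon ⟨r, ⟨hr.pos, h⟩, hN⟩
  obtain ⟨i, n, h1⟩ := key p hp (by omega)
  obtain ⟨j, n', h2⟩ := key q hq (by omega)
  have hi := hB i
  have hj := hB j
  exact aux_prime δ (l i) (l j) p q hp hq (by omega) (hl i) (hl j) (by omega) (by omega)
    (by omega) n n' h1 h2
end

section
/- Let X be a set, f : X → X a map, P, Q predicates on X such that every point satisfying P also satisfies Q, and (Yₙ)_{n≥1} a countable family of subsets of X. For a self-map g : X → X, say that g satisfies condition (*) if: for every finite list of points x₁, …, x_k ∈ X all satisfying Q and every index n ≥ 1, there exists a point x ∈ X such that x satisfies P, x ∉ Yₙ, and O_g(x) ∩ O_g(xᵢ) = ∅ for all 1 ≤ i ≤ k. Assume moreover that Q is preserved by f, i.e. if x satisfies Q then f(x) satisfies Q. If the iterate f^m satisfies (*) for some integer m > 0, then f itself satisfies (*). -/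
/-- The forward orbit of a point under a self-map. -/
def forwardOrbit {X : Type*} (f : X → X) (x : X) : Set X :=
  Set.range fun n : ℕ => f^[n] x

/-- Condition (*) for a self-map `g`, relative to the family `Y` and the
predicates `P`, `Q`. -/
def starCond {X : Type*} (Y : ℕ → Set X) (P Q : X → Prop) (g : X → X) : Prop :=
  ∀ (k : ℕ) (xs : Fin k → X), (∀ i, Q (xs i)) → ∀ n : ℕ,
    ∃ x : X, P x ∧ x ∉ Y n ∧
      ∀ i, forwardOrbit g x ∩ forwardOrbit g (xs i) = ∅

/-- Lemma 3.2 (combinatorial content): if `Q` is preserved by `f` and some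
iterate `f^m` (with `m > 0`) satisfies (*), then `f` satisfies (*). -/
theorem stmt_4 {X : Type*} (f : X → X) (P Q : X → Prop)
    (hPQ : ∀ x, P x → Q x) (Y : ℕ → Set X)
    (hQf : ∀ x, Q x → Q (f x))
    (m : ℕ) (hm : 0 < m) (h : starCond Y P Q (f^[m])) :
    starCond Y P Q f := by
  intro k xs hxs n
  have hQ : ∀ (j : ℕ) (x : X), Q x → Q (f^[j] x) := by
    intro j
    induction j with
    | zero => intro x hx; exact hx
    | succ j ih =>
      intro x hx
      rw [Function.iterate_succ_apply]
      exact ih _ (hQf x hx)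
  obtain ⟨x, hP, hY, hd⟩ := h (k * m)
    (fun t => f^[((finProdFinEquiv.symm t).2 : ℕ)] (xs (finProdFinEquiv.symm t).1))
    (fun t => hQ _ _ (hxs _)) n
  refine ⟨x, hP, hY, fun i => ?_⟩
  rw [Set.eq_empty_iff_forall_notMem]
  rintro y ⟨⟨a, ha⟩, ⟨b, hb⟩⟩
  have hab : f^[a] x = f^[b] (xs i) := ha.trans hb.symm
  obtain ⟨c, rfl⟩ : ∃ c, m = c + 1 := ⟨m - 1, by omega⟩
  have h1 : f^[(c + 1) * a] x = f^[c * a + b] (xs i) := by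
    rw [Function.iterate_add_apply, ← hab, ← Function.iterate_add_apply]
    congr 2
    ring
  have hdi := hd (finProdFinEquiv (i, ⟨(c * a + b) % (c + 1), Nat.mod_lt _ hm⟩))
  simp only [Equiv.symm_apply_apply] at hdi
  rw [Set.eq_empty_iff_forall_notMem] at hdi
  refine hdi (f^[(c + 1) * a] x) ⟨⟨a, ?_⟩, ⟨(c * a + b) / (c + 1), ?_⟩⟩
  · show (f^[c + 1])^[a] x = _
    rw [← Function.iterate_mul]
  · show (f^[c + 1])^[(c * a + b) / (c + 1)] _ = _
    rw [← Function.iterate_mul, ← Function.iterate_add_apply, Nat.div_add_mod, h1]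
end

section
/- Let X and Y be sets, f : X → X, g : Y → Y, and π : X → Y maps satisfying g ∘ π = π ∘ f, and suppose there is a positive integer A such that every fiber of π has at most A elements, i.e. |π⁻¹(y)| ≤ A for all y ∈ Y. Let S ⊆ X be a set of points whose forward f-orbits are pairwise disjoint, i.e. O_f(x) ∩ O_f(x') = ∅ for all distinct x, x' ∈ S. Then for every y ∈ Y, the set {x ∈ S : O_g(π(x)) ∩ O_g(y) ≠ ∅} has at most A elements. -/
/-- Lemma 2.3 (set-theoretic core): if `π` intertwines `f` and `g`, has fibers
of cardinality at most `A`, and `S` is a set of points with pairwise disjoint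
forward `f`-orbits, then for each `y` at most `A` points of `S` have image
whose forward `g`-orbit meets the forward `g`-orbit of `y`. -/
theorem stmt_5 {X Y : Type*} (f : X → X) (g : Y → Y) (π : X → Y)
    (hcomm : g ∘ π = π ∘ f) (A : ℕ) (hA : 0 < A)
    (hfib : ∀ y : Y, (π ⁻¹' {y}).encard ≤ (A : ℕ∞))
    (S : Set X)
    (hS : ∀ x ∈ S, ∀ x' ∈ S, x ≠ x' →
      forwardOrbit f x ∩ forwardOrbit f x' = ∅)
    (y : Y) :
    {x ∈ S | (forwardOrbit g (π x) ∩ forwardOrbit g y).Nonempty}.encard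
      ≤ (A : ℕ∞) := by
  by_contra hlt
  rw [not_le] at hlt
  have hle : ((A + 1 : ℕ) : ℕ∞) ≤
      {x ∈ S | (forwardOrbit g (π x) ∩ forwardOrbit g y).Nonempty}.encard := by
    push_cast
    exact Order.add_one_le_of_lt hlt
  obtain ⟨T, hT, hTc⟩ := Set.exists_subset_encard_eq hle
  have hTfin : T.Finite := Set.finite_of_encard_eq_coe hTc
  have h : ∀ x : X, ∃ n m : ℕ, x ∈ T → g^[n] (π x) = g^[m] y := by
    intro x
    by_cases hx : x ∈ T
    · obtain ⟨_, _, ⟨n, hn⟩, ⟨m, hm⟩⟩ := hT hx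
      exact ⟨n, m, fun _ => hn.trans hm.symm⟩
    · exact ⟨0, 0, fun h => absurd h hx⟩
  choose n m hnm using h
  obtain ⟨M, hM⟩ := (hTfin.image m).bddAbove
  have hM' : ∀ x ∈ T, m x ≤ M := fun x hx => hM ⟨x, hx, rfl⟩
  have hsemi : Function.Semiconj π f g := fun x => (congrFun hcomm x).symm
  have hmaps : Set.MapsTo (fun x => f^[(M - m x) + n x] x) T (π ⁻¹' {g^[M] y}) := by
    intro x hx
    change π (f^[(M - m x) + n x] x) = g^[M] y
    rw [(hsemi.iterate_right _).eq, Function.iterate_add_apply, hnm x hx,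
      ← Function.iterate_add_apply, Nat.sub_add_cancel (hM' x hx)]
  have hinj : Set.InjOn (fun x => f^[(M - m x) + n x] x) T := by
    intro x hx x' hx' he
    by_contra hne
    have h0 := hS x (hT hx).1 x' (hT hx').1 hne
    have : f^[(M - m x) + n x] x ∈ forwardOrbit f x ∩ forwardOrbit f x' :=
      ⟨⟨_, rfl⟩, ⟨_, he.symm⟩⟩
    rw [h0] at this
    exact this
  have h1 := (Set.encard_le_encard_of_injOn hmaps hinj).trans (hfib _)
  rw [hTc] at h1
  have h2 : A + 1 ≤ A := by exact_mod_cast h1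
  omega
end

section
/- Let X be a set, f : X → X a map, A a positive integer, and d : X → ℤ_{>0} a function such that for every x ∈ X, d(f(x)) divides d(x) and d(x)/d(f(x)) ≤ A. Let y ∈ X be a point with d(y) ≤ A, and let x ∈ X be a point such that d(x) has a prime factor p > A. Then the forward orbits of x and y under f are disjoint: O_f(x) ∩ O_f(y) = ∅. -/
/-- Arithmetic core of the Claim in the proof of Theorem 1.6: if
`d(f(x)) ∣ d(x)` with ratio at most `A` for every point, `d(y) ≤ A`, and
`d(x)` has a prime factor `p > A`, then the forward orbits of `x` and `y`
are disjoint. -/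
theorem stmt_9 {X : Type*} (f : X → X) (A : ℕ) (hA : 0 < A)
    (d : X → ℕ) (hd : ∀ x, 0 < d x)
    (hdvd : ∀ x, d (f x) ∣ d x) (hratio : ∀ x, d x / d (f x) ≤ A)
    (y : X) (hy : d y ≤ A)
    (x : X) (p : ℕ) (hp : p.Prime) (hpd : p ∣ d x) (hpA : A < p) :
    forwardOrbit f x ∩ forwardOrbit f y = ∅ := by
  have h1 : ∀ n : ℕ, p ∣ d (f^[n] x) := by
    intro n
    induction n with
    | zero => simpa using hpd
    | succ n ih =>
      rw [Function.iterate_succ_apply']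
      obtain ⟨c, hc⟩ := hdvd (f^[n] x)
      have hr := hratio (f^[n] x)
      have hpos := hd (f^[n] x)
      rw [hc] at ih hr hpos
      rw [Nat.mul_div_cancel_left c (hd _)] at hr
      rcases hp.dvd_mul.mp ih with h | h
      · exact h
      · have hc0 : 0 < c := Nat.pos_of_mul_pos_left hpos
        have := Nat.le_of_dvd hc0 h
        omega
  have h2 : ∀ n : ℕ, d (f^[n] y) ≤ A := by
    intro n
    induction n with
    | zero => simpa using hy
    | succ n ih =>
      rw [Function.iterate_succ_apply']
      exact (Nat.le_of_dvd (hd _) (hdvd _)).trans ih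
  ext z
  simp only [Set.mem_inter_iff, Set.mem_empty_iff_false, iff_false]
  rintro ⟨⟨n, hn⟩, ⟨m, hm⟩⟩
  have a := h1 n
  have b := h2 m
  simp only at hn hm
  rw [hn] at a
  rw [hm] at b
  have := Nat.le_of_dvd (hd z) a
  omega
end
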